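/- arXiv:math/9908021 — 8 statements merged into one kernel-verified Lean document; each statement's English description precedes it below -/
import Mathlib

section
/- Let U be a bounded linear operator on a complex Hilbert space H₀, let K ⊆ H₀ be a closed subspace with U(K) ⊆ K, and let J be a period-2 unitary on H₀ satisfying J U J = U* and such that K is J-positive. Then there exist a complex Hilbert space H', a continuous linear map W : K → H' with ‖W k‖ ≤ ‖k‖ for all k ∈ K and with dense range, and a bounded selfadjoint operator S on H' such that: (i) S (W k) = W (U k) for every k ∈ K; (ii) ⟨W k₁, W k₂⟩ = ⟨k₁, J k₂⟩ for all k₁, k₂ ∈ K; and (iii) ‖S‖ ≤ (spectralRadius(U ∘ U))^{1/2}. -/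
open scoped ComplexConjugate

local notation "⟪" x ", " y "⟫" => @inner ℂ _ _ x y

/-- A log-convex nonnegative sequence whose exponential growth rate is at most `c` satisfies
`a 1 ≤ c * a 0`. -/
lemma le_mul_of_sq_le_mul_of_growth {a : ℕ → ℝ} (ha : ∀ n, 0 ≤ a n)
    (hlog : ∀ n, a (n + 1) ^ 2 ≤ a n * a (n + 2)) {c C : ℝ} (hc : 0 ≤ c)
    (hgrowth : ∀ s, c < s → ∀ᶠ n in Filter.atTop, a n ≤ C * s ^ n) : a 1 ≤ c * a 0 := by
  rcases (ha 0).eq_or_lt with h0 | h0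
  · have := hlog 0
    rw [← h0] at this ⊢
    nlinarith
  by_contra! hlt
  obtain ⟨t, ht⟩ : ∃ t, t = a 1 / a 0 := ⟨_, rfl⟩
  have ht1 : a 1 = t * a 0 := by rw [ht]; field_simp
  have hct : c < t := by rw [ht, lt_div_iff₀ h0]; exact hlt
  have htpos : 0 < t := hc.trans_lt hct
  have hstep : ∀ n, 0 < a n ∧ t * a n ≤ a (n + 1) := by
    intro n
    induction n with
    | zero => exact ⟨h0, ht1.ge⟩
    | succ n ih =>
      obtain ⟨hn, hn1⟩ := ih
      have hpos : 0 < a (n + 1) := (mul_pos htpos hn).trans_le hn1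
      refine ⟨hpos, le_of_mul_le_mul_left ?_ hn⟩
      calc a n * (t * a (n + 1)) = (t * a n) * a (n + 1) := by ring
        _ ≤ a (n + 1) * a (n + 1) := by gcongr
        _ = a (n + 1) ^ 2 := by ring
        _ ≤ _ := hlog n
  have hlower : ∀ n, t ^ n * a 0 ≤ a n := by
    intro n
    induction n with
    | zero => simp
    | succ n ih =>
      calc t ^ (n + 1) * a 0 = t * (t ^ n * a 0) := by ring
        _ ≤ t * a n := by gcongr
        _ ≤ _ := (hstep n).2
  obtain ⟨s, hcs, hst⟩ := exists_between hct
  have hs : 0 < s := hc.trans_lt hcs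
  have hlim := tendsto_pow_atTop_atTop_of_one_lt ((one_lt_div hs).2 hst)
  obtain ⟨n, hn, hn'⟩ :=
    ((hgrowth s hcs).and (hlim.eventually_gt_atTop (C / a 0))).exists
  rw [div_pow, div_lt_div_iff₀ h0 (pow_pos hs n)] at hn'
  linarith [hlower n]

/-- The spectral radius in a complex Banach algebra is finite. -/
lemma spectralRadius_ne_top {A : Type*} [NormedRing A] [NormedAlgebra ℂ A] [CompleteSpace A]
    (a : A) : spectralRadius ℂ a ≠ ⊤ := by
  have h := spectrum.spectralRadius_le_pow_nnnorm_pow_one_div ℂ a 0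
  refine ne_top_of_le_ne_top ?_ h
  simp [ENNReal.mul_eq_top]

lemma eventually_norm_pow_le_of_spectralRadius_lt {A : Type*} [NormedRing A] [NormedAlgebra ℂ A]
    [CompleteSpace A] (a : A) {s : ℝ} (hs : (spectralRadius ℂ a).toReal < s) :
    ∀ᶠ n : ℕ in Filter.atTop, ‖a ^ n‖ ≤ s ^ n := by
  have hs0 : 0 < s := ENNReal.toReal_nonneg.trans_lt hs
  have hlt : spectralRadius ℂ a < ENNReal.ofReal s :=
    (ENNReal.lt_ofReal_iff_toReal_lt (spectralRadius_ne_top a)).2 hs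
  filter_upwards [(spectrum.pow_norm_pow_one_div_tendsto_nhds_spectralRadius a).eventually_lt_const
    hlt, Filter.eventually_ge_atTop 1] with n hn hn1
  have h := ((ENNReal.ofReal_lt_ofReal_iff hs0).1 hn).le
  have hn0 : n ≠ 0 := by omega
  calc ‖a ^ n‖ = (‖a ^ n‖ ^ (1 / n : ℝ)) ^ n := by
        rw [one_div, Real.rpow_inv_natCast_pow (norm_nonneg _) hn0]
    _ ≤ s ^ n := by gcongr

/-- A positive operator `A` factors as `W† W` with `W` of dense range. -/
lemma ContinuousLinearMap.IsPositive.exists_denseRange_factorization {E : Type u}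
    [NormedAddCommGroup E] [InnerProductSpace ℂ E] [CompleteSpace E] {A : E →L[ℂ] E}
    (hA : A.IsPositive) :
    ∃ (H' : Type u) (_ : NormedAddCommGroup H') (_ : InnerProductSpace ℂ H')
      (_ : CompleteSpace H') (W : E →L[ℂ] H'), DenseRange W ∧
      ∀ x y : E, ⟪W x, W y⟫ = ⟪x, A y⟫ := by
  have hA0 : 0 ≤ A := (ContinuousLinearMap.nonneg_iff_isPositive A).2 hA
  set T := CFC.sqrt A with hT
  have hTsa : IsSelfAdjoint T := IsSelfAdjoint.of_nonneg (CFC.sqrt_nonneg A)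
  have hTT : T * T = A := CFC.sqrt_mul_sqrt_self A hA0
  let M := (LinearMap.range T.toLinearMap).topologicalClosure
  refine ⟨M, inferInstance, inferInstance, inferInstance,
    T.codRestrict M fun x ↦ Submodule.le_topologicalClosure _ ⟨x, rfl⟩, ?_, fun x y ↦ ?_⟩
  · intro y
    rw [closure_subtype, ← Set.range_comp]
    exact y.2
  · rw [← hTT]
    change ⟪T x, T y⟫ = ⟪x, T (T y)⟫
    exact hTsa.isSymmetric x (T y)

/-- The Cauchy–Schwarz step for a map `v` that is symmetric relative to `⟪W ·, W ·⟫`. -/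
lemma sq_norm_le_of_symmetric {E F : Type*} [NormedAddCommGroup F] [InnerProductSpace ℂ F]
    (v : E → E) (W : E → F) (h : ∀ x y, ⟪W (v x), W y⟫ = ⟪W x, W (v y)⟫) (k : E) :
    ‖W (v k)‖ ^ 2 ≤ ‖W k‖ * ‖W (v (v k))‖ :=
  calc ‖W (v k)‖ ^ 2 = ‖⟪W (v k), W (v k)⟫‖ := by simp [inner_self_eq_norm_sq_to_K]
    _ = ‖⟪W k, W (v (v k))⟫‖ := by rw [h]
    _ ≤ _ := norm_inner_le_norm _ _

/-- existence of the selfadjoint realization `(H', W, S)` of an operator `U`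
with reflection symmetry `J U J = U*` relative to a `J`-positive invariant subspace `K`. -/
theorem reflection_symmetry_existence {H₀ : Type u}
    [NormedAddCommGroup H₀] [InnerProductSpace ℂ H₀] [CompleteSpace H₀]
    (U J : H₀ →L[ℂ] H₀) (K : Submodule ℂ H₀) (hKc : IsClosed (K : Set H₀))
    (hUK : ∀ x ∈ K, U x ∈ K)
    (hJ2 : J ∘L J = 1) (hJiso : ∀ x : H₀, ‖J x‖ = ‖x‖)
    (hJU : J ∘L U ∘L J = ContinuousLinearMap.adjoint U)
    (hpos : ∀ k ∈ K, 0 ≤ (⟪k, J k⟫).re) :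
    ∃ (H' : Type u) (_ : NormedAddCommGroup H') (_ : InnerProductSpace ℂ H')
      (_ : CompleteSpace H') (W : K →L[ℂ] H') (S : H' →L[ℂ] H'),
      (∀ k : K, ‖W k‖ ≤ ‖k‖) ∧ DenseRange W ∧ IsSelfAdjoint S ∧
      (∀ k : K, S (W k) = W ⟨U k, hUK k k.2⟩) ∧
      (∀ k₁ k₂ : K, ⟪W k₁, W k₂⟫ = ⟪(k₁ : H₀), J k₂⟫) ∧
      ‖S‖ ≤ Real.sqrt (spectralRadius ℂ (U ∘L U)).toReal := by
  have hJJ (x : H₀) : J (J x) = x := DFunLike.congr_fun hJ2 x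
  have hJsymm (x y : H₀) : ⟪J x, y⟫ = ⟪x, J y⟫ := by
    have hinner := (LinearMap.norm_map_iff_inner_map_map J).1 hJiso
    rw [← hinner x (J y), hJJ]
  have hUJ (x y : H₀) : ⟪U x, J y⟫ = ⟪x, J (U y)⟫ := by
    rw [← ContinuousLinearMap.adjoint_inner_right, ← hJU]
    simp [hJJ]
  have : CompleteSpace K := hKc.completeSpace_coe
  let A : K →L[ℂ] K := ContinuousLinearMap.adjoint K.subtypeL ∘L J ∘L K.subtypeL
  have hA (x y : K) : ⟪x, A y⟫ = ⟪(x : H₀), J y⟫ :=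
    ContinuousLinearMap.adjoint_inner_right K.subtypeL x (J y)
  have hA' (x y : K) : ⟪A x, y⟫ = ⟪(x : H₀), J y⟫ :=
    (ContinuousLinearMap.adjoint_inner_left K.subtypeL y (J x)).trans (hJsymm _ _)
  have hApos : A.IsPositive := by
    refine ⟨fun x y ↦ (hA' x y).trans (hA x y).symm, fun x ↦ ?_⟩
    rw [ContinuousLinearMap.reApplyInnerSelf_apply, hA']
    exact hpos x x.2
  obtain ⟨H', i₁, i₂, i₃, W, hWd, hW⟩ := hApos.exists_denseRange_factorization
  replace hW (x y : K) : ⟪W x, W y⟫ = ⟪(x : H₀), J y⟫ := (hW x y).trans (hA x y)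
  have hWle (k : K) : ‖W k‖ ≤ ‖k‖ := by
    refine (pow_le_pow_iff_left₀ (norm_nonneg _) (norm_nonneg _) two_ne_zero).1 ?_
    calc ‖W k‖ ^ 2 = ‖⟪W k, W k⟫‖ := by simp [inner_self_eq_norm_sq_to_K]
      _ ≤ ‖(k : H₀)‖ * ‖J k‖ := by rw [hW]; exact norm_inner_le_norm _ _
      _ = ‖k‖ ^ 2 := by rw [hJiso, sq]; rfl
  let u : K →L[ℂ] K := U.restrict hUK
  have hWu (x y : K) : ⟪W (u x), W y⟫ = ⟪W x, W (u y)⟫ := by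
    rw [hW, hW]; exact hUJ _ _
  have hbound (k : K) : ‖W (u (u k))‖ ≤ (spectralRadius ℂ (U ∘L U)).toReal * ‖W k‖ := by
    have hpow (n : ℕ) : (((u * u) ^ n) k : H₀) = ((U ∘L U) ^ n) k := by
      induction n with
      | zero => rfl
      | succ n ih => rw [pow_succ', pow_succ']; exact congrArg (fun x ↦ U (U x)) ih
    have := le_mul_of_sq_le_mul_of_growth (a := fun n ↦ ‖W (((u * u) ^ n) k)‖) (C := ‖k‖)
      (c := (spectralRadius ℂ (U ∘L U)).toReal)
      (fun _ ↦ norm_nonneg _) (fun n ↦ ?_) ENNReal.toReal_nonneg fun s hs ↦ ?_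
    · simpa using this
    · have hsucc (m : ℕ) : ((u * u) ^ (m + 1)) k = u (u (((u * u) ^ m) k)) := by
        rw [pow_succ']; rfl
      simp only [hsucc]
      refine sq_norm_le_of_symmetric (fun x ↦ u (u x)) W (fun x y ↦ ?_) _
      rw [hWu, hWu]
    · filter_upwards [eventually_norm_pow_le_of_spectralRadius_lt (U ∘L U) hs] with n hn
      calc ‖W (((u * u) ^ n) k)‖ ≤ ‖((U ∘L U) ^ n) k‖ := by
            rw [← hpow]; exact hWle _
        _ ≤ ‖(U ∘L U) ^ n‖ * ‖k‖ := ContinuousLinearMap.le_opNorm _ _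
        _ ≤ s ^ n * ‖k‖ := by gcongr
        _ = ‖k‖ * s ^ n := mul_comm _ _
  have hnorm (k : K) :
      ‖W (u k)‖ ≤ Real.sqrt (spectralRadius ℂ (U ∘L U)).toReal * ‖W k‖ := by
    refine (pow_le_pow_iff_left₀ (norm_nonneg _) (by positivity) two_ne_zero).1 ?_
    rw [mul_pow, Real.sq_sqrt ENNReal.toReal_nonneg]
    calc ‖W (u k)‖ ^ 2 ≤ ‖W k‖ * ‖W (u (u k))‖ := sq_norm_le_of_symmetric u W hWu k
      _ ≤ ‖W k‖ * ((spectralRadius ℂ (U ∘L U)).toReal * ‖W k‖) := by gcongr; exact hbound k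
      _ = _ := by ring
  let S : H' →L[ℂ] H' := (W ∘L u).toLinearMap.extendOfNorm W.toLinearMap
  have hS (k : K) : S (W k) = W (u k) :=
    LinearMap.extendOfNorm_eq (f := (W ∘L u).toLinearMap) (e := W.toLinearMap) hWd ⟨_, hnorm⟩ k
  refine ⟨H', i₁, i₂, i₃, W, S, hWle, hWd, ?_, hS, hW,
    LinearMap.opNorm_extendOfNorm_le hWd (Real.sqrt_nonneg _) hnorm⟩
  rw [ContinuousLinearMap.isSelfAdjoint_iff_isSymmetric]
  intro x y
  change ⟪S x, y⟫ = ⟪x, S y⟫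
  induction x, y using hWd.induction_on₂ with
  | hp => exact isClosed_eq (by fun_prop) (by fun_prop)
  | h x y => rw [hS, hS, hWu]
end

section
/- Let U be a bounded linear operator on a complex Hilbert space H₀, let K ⊆ H₀ be a closed subspace with U(K) ⊆ K, and let J be a period-2 unitary on H₀ satisfying J U J = U* and such that K is J-positive. Then for every k ∈ K, Re⟨U k, J (U k)⟩ ≤ spectralRadius(U ∘ U) · Re⟨k, J k⟩. -/
open scoped ComplexConjugate

local notation "⟪" x ", " y "⟫" => @inner ℂ _ _ x y

open Filter Topology

/-- The Cauchy–Schwarz inequality for the real part of a hermitian sesquilinear form that is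
nonnegative on a subspace. -/
theorem sq_re_inner_le_of_nonneg_on {E : Type*} [NormedAddCommGroup E] [InnerProductSpace ℂ E]
    {J : E →L[ℂ] E} {K : Submodule ℂ E} (hJ : ∀ x y, ⟪J x, y⟫ = ⟪x, J y⟫)
    (hpos : ∀ k ∈ K, 0 ≤ (⟪k, J k⟫).re) {x y : E} (hx : x ∈ K) (hy : y ∈ K) :
    (⟪x, J y⟫).re ^ 2 ≤ (⟪x, J x⟫).re * (⟪y, J y⟫).re := by
  have hsymm : (⟪y, J x⟫).re = (⟪x, J y⟫).re := by
    rw [← hJ, ← inner_conj_symm, Complex.conj_re]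
  have hquad : ∀ t : ℝ, 0 ≤ (⟪y, J y⟫).re * (t * t) + 2 * (⟪x, J y⟫).re * t + (⟪x, J x⟫).re := by
    intro t
    have h := hpos (x + (t : ℂ) • y) (K.add_mem hx (K.smul_mem _ hy))
    simp only [map_add, map_smul, inner_add_left, inner_add_right, inner_smul_left,
      inner_smul_right, Complex.conj_ofReal, Complex.add_re, Complex.re_ofReal_mul, hsymm] at h
    linarith
  have hd := discrim_le_zero hquad
  rw [discrim] at hd
  linarith

/-- If a nonnegative sequence satisfies `c n ^ 2 ≤ c 0 * c (2 * n)`, then the ratio `c 1 / c 0` is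
controlled by the growth of `c` along powers of two. -/
theorem div_pow_two_pow_le_of_sq_le {c : ℕ → ℝ} (h₀ : 0 < c 0) (h₁ : 0 ≤ c 1)
    (hc : ∀ n, c n ^ 2 ≤ c 0 * c (2 * n)) (m : ℕ) :
    (c 1 / c 0) ^ 2 ^ m ≤ c (2 ^ m) / c 0 := by
  induction m with
  | zero => simp
  | succ m ih =>
    calc (c 1 / c 0) ^ 2 ^ (m + 1) = ((c 1 / c 0) ^ 2 ^ m) ^ 2 := by rw [← pow_mul, pow_succ]
      _ ≤ (c (2 ^ m) / c 0) ^ 2 := by gcongr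
      _ = c (2 ^ m) ^ 2 / c 0 ^ 2 := div_pow _ _ _
      _ ≤ c 0 * c (2 * 2 ^ m) / c 0 ^ 2 := by gcongr; exact hc _
      _ = c (2 ^ (m + 1)) / c 0 := by rw [pow_succ' 2 m]; field_simp

/-- A real number whose powers are, up to a constant and along powers of two, dominated by the norms
of the powers of `a` is at most the spectral radius of `a`. -/
theorem le_toReal_spectralRadius_of_pow_le {A : Type*} [NormedRing A] [NormedAlgebra ℂ A]
    [CompleteSpace A] [NormOneClass A] (a : A) {r C : ℝ} (hr : 0 ≤ r) (hC : 0 < C)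
    (h : ∀ m : ℕ, r ^ 2 ^ m ≤ C * ‖a ^ 2 ^ m‖) : r ≤ (spectralRadius ℂ a).toReal := by
  have hfin : spectralRadius ℂ a ≠ ⊤ :=
    ((spectrum.spectralRadius_le_nnnorm a).trans_lt ENNReal.coe_lt_top).ne
  have hpow : Tendsto (fun m : ℕ => 2 ^ m) atTop atTop :=
    tendsto_pow_atTop_atTop_of_one_lt one_lt_two
  have hnorm : Tendsto (fun n : ℕ => ‖a ^ n‖ ^ (1 / n : ℝ)) atTop
      (𝓝 (spectralRadius ℂ a).toReal) := by
    have := (ENNReal.tendsto_toReal hfin).comp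
      (spectrum.pow_norm_pow_one_div_tendsto_nhds_spectralRadius a)
    refine this.congr fun n => ?_
    exact ENNReal.toReal_ofReal (by positivity)
  have hconst : Tendsto (fun n : ℕ => C ^ (1 / n : ℝ)) atTop (𝓝 1) := by
    simpa using tendsto_const_nhds.rpow (tendsto_one_div_atTop_nhds_zero_nat (𝕜 := ℝ))
      (Or.inl hC.ne')
  have hlim := (hconst.mul hnorm).comp hpow
  rw [one_mul] at hlim
  refine ge_of_tendsto' hlim fun m => ?_
  simp only [Function.comp_apply]
  rw [← Real.mul_rpow hC.le (norm_nonneg _), one_div]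
  calc r = (r ^ 2 ^ m) ^ (((2 ^ m : ℕ) : ℝ)⁻¹) :=
        (Real.pow_rpow_inv_natCast hr (by positivity)).symm
    _ ≤ _ := Real.rpow_le_rpow (by positivity) (h m) (by positivity)

/-- the basic reflection-positivity estimate
`Re⟨U k, J U k⟩ ≤ sp(U²) · Re⟨k, J k⟩` for `k` in the `J`-positive invariant subspace `K`. -/
theorem reflection_symmetry_estimate {H₀ : Type*}
    [NormedAddCommGroup H₀] [InnerProductSpace ℂ H₀] [CompleteSpace H₀]
    (U J : H₀ →L[ℂ] H₀) (K : Submodule ℂ H₀) (hKc : IsClosed (K : Set H₀))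
    (hUK : ∀ x ∈ K, U x ∈ K)
    (hJ2 : J ∘L J = 1) (hJiso : ∀ x : H₀, ‖J x‖ = ‖x‖)
    (hJU : J ∘L U ∘L J = ContinuousLinearMap.adjoint U)
    (hpos : ∀ k ∈ K, 0 ≤ (⟪k, J k⟫).re) :
    ∀ k ∈ K, (⟪U k, J (U k)⟫).re ≤ (spectralRadius ℂ (U ∘L U)).toReal * (⟪k, J k⟫).re := by
  have hJJ : ∀ x, J (J x) = x := fun x => DFunLike.congr_fun hJ2 x
  have hJsymm : ∀ x y, ⟪J x, y⟫ = ⟪x, J y⟫ := fun x y => by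
    have h := LinearIsometry.inner_map_map (⟨J.toLinearMap, hJiso⟩ : H₀ →ₗᵢ[ℂ] H₀) x (J y)
    simpa [hJJ] using h
  have hU : ∀ x y, ⟪U x, J y⟫ = ⟪x, J (U y)⟫ := fun x y => by
    rw [← ContinuousLinearMap.adjoint_inner_right, ← hJU]
    simp [hJJ]
  have hUn : ∀ (n : ℕ) (x y : H₀), ⟪(U ^ n) x, J y⟫ = ⟪x, J ((U ^ n) y)⟫ := by
    intro n
    induction n with
    | zero => simp
    | succ n ih =>
      intro x y
      rw [pow_succ, mul_apply_eq_comp, ih, hU, ← pow_succ, pow_succ', mul_apply_eq_comp]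
  have hUnK : ∀ (n : ℕ), ∀ x ∈ K, (U ^ n) x ∈ K := by
    intro n
    induction n with
    | zero => simp
    | succ n ih => exact fun x hx => ih _ (hUK x hx)
  intro k hk
  have hsq : U ∘L U = U ^ 2 := (sq U).symm
  rw [hsq]
  set c : ℕ → ℝ := fun n => (⟪k, J (((U ^ 2) ^ n) k)⟫).re with hc
  have hc_eq : ∀ n, c n = (⟪(U ^ n) k, J ((U ^ n) k)⟫).re := fun n => by
    rw [hUn, ← mul_apply_eq_comp (U ^ n), ← pow_add, ← two_mul, pow_mul]
  have hc_nonneg : ∀ n, 0 ≤ c n := fun n => hc_eq n ▸ hpos _ (hUnK n k hk)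
  have hc0 : (⟪k, J k⟫).re = c 0 := by simp [hc]
  have hc1 : (⟪U k, J (U k)⟫).re = c 1 := by simp [hc_eq]
  have hc_sq : ∀ n, c n ^ 2 ≤ c 0 * c (2 * n) := fun n => by
    rw [hc_eq (2 * n), ← hc0, pow_mul]
    exact sq_re_inner_le_of_nonneg_on hJsymm hpos hk (pow_mul U 2 n ▸ hUnK (2 * n) k hk)
  rw [hc0, hc1]
  rcases (hc_nonneg 0).eq_or_lt with h0 | h0
  · have h := hc_sq 1
    rw [← h0, zero_mul] at h
    rw [← h0, mul_zero]
    exact (pow_eq_zero_iff two_ne_zero).1 (le_antisymm h (sq_nonneg _)) |>.le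
  have hk0 : k ≠ 0 := by
    rintro rfl
    simp [hc] at h0
  have : Nontrivial H₀ := ⟨k, 0, hk0⟩
  rw [← div_le_iff₀ h0]
  refine le_toReal_spectralRadius_of_pow_le (U ^ 2) (C := ‖k‖ ^ 2 / c 0)
    (div_nonneg (hc_nonneg 1) h0.le) (by positivity) fun m => ?_
  calc (c 1 / c 0) ^ 2 ^ m ≤ c (2 ^ m) / c 0 :=
        div_pow_two_pow_le_of_sq_le h0 (hc_nonneg 1) hc_sq m
    _ ≤ ‖k‖ * (‖(U ^ 2) ^ 2 ^ m‖ * ‖k‖) / c 0 := by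
        gcongr
        calc c (2 ^ m) ≤ ‖k‖ * ‖J (((U ^ 2) ^ 2 ^ m) k)‖ := re_inner_le_norm (𝕜 := ℂ) _ _
          _ ≤ _ := by
            rw [hJiso]
            gcongr
            exact ContinuousLinearMap.le_opNorm _ _
    _ = ‖k‖ ^ 2 / c 0 * ‖(U ^ 2) ^ 2 ^ m‖ := by ring
end

section
/- Let U be a bounded linear operator on a complex Hilbert space H₀, let K ⊆ H₀ be a closed subspace with U(K) ⊆ K, and let J be a period-2 unitary on H₀ satisfying J U J = U* and such that K is J-positive. Suppose for i = 1, 2 we are given a complex Hilbert space Hᵢ, a continuous linear map Wᵢ : K → Hᵢ with dense range, and a bounded selfadjoint operator Sᵢ on Hᵢ such that Sᵢ(Wᵢ k) = Wᵢ(U k) for all k ∈ K and ⟨Wᵢ k₁, Wᵢ k₂⟩ = ⟨k₁, J k₂⟩ for all k₁, k₂ ∈ K. Then there exists a unitary isomorphism (linear isometric equivalence) T : H₁ → H₂ such that T ∘ W₁ = W₂ and T ∘ S₁ = S₂ ∘ T. -/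
open scoped ComplexConjugate

local notation "⟪" x ", " y "⟫" => @inner ℂ _ _ x y

/-- uniqueness (up to unitary equivalence) of the selfadjoint realization
`(Hᵢ, Wᵢ, Sᵢ)` of an operator with reflection symmetry. -/
theorem reflection_symmetry_uniqueness {H₀ : Type*}
    [NormedAddCommGroup H₀] [InnerProductSpace ℂ H₀] [CompleteSpace H₀]
    {H₁ : Type*} [NormedAddCommGroup H₁] [InnerProductSpace ℂ H₁] [CompleteSpace H₁]
    {H₂ : Type*} [NormedAddCommGroup H₂] [InnerProductSpace ℂ H₂] [CompleteSpace H₂]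
    (U J : H₀ →L[ℂ] H₀) (K : Submodule ℂ H₀) (hKc : IsClosed (K : Set H₀))
    (hUK : ∀ x ∈ K, U x ∈ K)
    (hJ2 : J ∘L J = 1) (hJiso : ∀ x : H₀, ‖J x‖ = ‖x‖)
    (hJU : J ∘L U ∘L J = ContinuousLinearMap.adjoint U)
    (hpos : ∀ k ∈ K, 0 ≤ (⟪k, J k⟫).re)
    (W₁ : K →L[ℂ] H₁) (W₂ : K →L[ℂ] H₂)
    (hW₁ : DenseRange W₁) (hW₂ : DenseRange W₂)
    (S₁ : H₁ →L[ℂ] H₁) (S₂ : H₂ →L[ℂ] H₂)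
    (hS₁ : IsSelfAdjoint S₁) (hS₂ : IsSelfAdjoint S₂)
    (hSW₁ : ∀ k : K, S₁ (W₁ k) = W₁ ⟨U k, hUK k k.2⟩)
    (hSW₂ : ∀ k : K, S₂ (W₂ k) = W₂ ⟨U k, hUK k k.2⟩)
    (hWJ₁ : ∀ k₁ k₂ : K, ⟪W₁ k₁, W₁ k₂⟫ = ⟪(k₁ : H₀), J k₂⟫)
    (hWJ₂ : ∀ k₁ k₂ : K, ⟪W₂ k₁, W₂ k₂⟫ = ⟪(k₁ : H₀), J k₂⟫) :
    ∃ T : H₁ ≃ₗᵢ[ℂ] H₂, (∀ k : K, T (W₁ k) = W₂ k) ∧ (∀ x : H₁, T (S₁ x) = S₂ (T x)) := by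
  have hnorm : ∀ k : K, ‖W₂ k‖ = ‖W₁ k‖ := fun k => by
    rw [norm_eq_sqrt_re_inner (𝕜 := ℂ), norm_eq_sqrt_re_inner (𝕜 := ℂ), hWJ₁, hWJ₂]
  let T : H₁ ≃ₗᵢ[ℂ] H₂ := LinearEquiv.extendOfIsometry (LinearEquiv.refl ℂ K)
    W₁.toLinearMap W₂.toLinearMap hW₁ hW₂ hnorm
  have hT : ∀ k : K, T (W₁ k) = W₂ k :=
    LinearEquiv.extendOfIsometry_eq _ _ _ hW₁ hW₂ hnorm
  refine ⟨T, hT, fun x => congrFun (hW₁.equalizer (T.continuous.comp S₁.continuous)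
    (S₂.continuous.comp T.continuous) (funext fun k => ?_)) x⟩
  simp only [Function.comp_apply]
  rw [hSW₁, hT, hT, hSW₂]
end

section
/- Let J be a period-2 unitary on a complex Hilbert space H₀, let H₊ and H₋ be the eigenspaces of J for the eigenvalues +1 and −1 respectively, and let K ⊆ H₀ be a closed subspace. Then K is J-positive if and only if there exist a closed subspace 𝒫 ⊆ H₊ and a linear map Λ : 𝒫 → H₋ with ‖Λ p‖ ≤ ‖p‖ for all p ∈ 𝒫, such that K = { p + Λ p : p ∈ 𝒫 } (i.e., K is the graph of a contraction from a closed subspace of H₊ into H₋). -/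
open scoped ComplexConjugate

local notation "⟪" x ", " y "⟫" => @inner ℂ _ _ x y

theorem re_inner_add_sub_self {E : Type*} [NormedAddCommGroup E] [InnerProductSpace ℂ E]
    (a b : E) : (inner ℂ (a + b) (a - b)).re = ‖a‖ ^ 2 - ‖b‖ ^ 2 := by
  have ha : (inner ℂ a a).re = ‖a‖ ^ 2 := inner_self_eq_norm_sq (𝕜 := ℂ) a
  have hb : (inner ℂ b b).re = ‖b‖ ^ 2 := inner_self_eq_norm_sq (𝕜 := ℂ) b
  have hab : (inner ℂ a b).re = (inner ℂ b a).re := inner_re_symm (𝕜 := ℂ) a b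
  simp only [inner_add_left, inner_sub_right, Complex.add_re, Complex.sub_re, ha, hb, hab]
  ring

/-- If `A + B = 1` and `B` is dominated in norm by `A` on a closed subspace `K`, then `A` is
injective on `K` with closed image. -/
theorem injective_and_isClosed_range_of_norm_le {E : Type*} [NormedAddCommGroup E]
    [NormedSpace ℂ E] [CompleteSpace E] (K : Submodule ℂ E) (hK : IsClosed (K : Set E))
    (A B : E →L[ℂ] E) (hAB : ∀ x, A x + B x = x) (hle : ∀ k ∈ K, ‖B k‖ ≤ ‖A k‖) :
    Function.Injective (A ∘L K.subtypeL) ∧ IsClosed (Set.range (A ∘L K.subtypeL)) := by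
  have := hK.completeSpace_coe
  have hanti : AntilipschitzWith 2 (A ∘L K.subtypeL) := by
    refine AddMonoidHomClass.antilipschitz_of_bound _ fun k ↦ ?_
    have hk := hle k k.2
    calc ‖k‖ = ‖A k + B k‖ := by rw [hAB]; rfl
      _ ≤ ‖A k‖ + ‖B k‖ := norm_add_le _ _
      _ ≤ 2 * ‖A k‖ := by linarith
  exact ⟨hanti.injective, hanti.isClosed_range (A ∘L K.subtypeL).uniformContinuous⟩

/-- a closed subspace `K` is `J`-positive iff it is the graph of a contraction
`Λ` from a closed subspace `𝒫` of the `+1` eigenspace of `J` into the `−1` eigenspace. -/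
theorem jpositive_iff_graph_of_contraction {H₀ : Type*}
    [NormedAddCommGroup H₀] [InnerProductSpace ℂ H₀] [CompleteSpace H₀]
    (J : H₀ →L[ℂ] H₀) (hJ2 : J ∘L J = 1) (hJiso : ∀ x : H₀, ‖J x‖ = ‖x‖)
    (K : Submodule ℂ H₀) (hKc : IsClosed (K : Set H₀)) :
    (∀ k ∈ K, 0 ≤ (⟪k, J k⟫).re) ↔
      ∃ P : Submodule ℂ H₀, IsClosed (P : Set H₀) ∧ (∀ p ∈ P, J p = p) ∧
        ∃ Λ : P →ₗ[ℂ] H₀, (∀ p : P, J (Λ p) = -(Λ p)) ∧ (∀ p : P, ‖Λ p‖ ≤ ‖p‖) ∧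
          (K : Set H₀) = {x : H₀ | ∃ p : P, (p : H₀) + Λ p = x} := by
  have hJJ (x : H₀) : J (J x) = x := DFunLike.congr_fun hJ2 x
  constructor
  · intro hpos
    let A : H₀ →L[ℂ] H₀ := (2⁻¹ : ℂ) • (1 + J)
    let B : H₀ →L[ℂ] H₀ := (2⁻¹ : ℂ) • (1 - J)
    have hJA (x : H₀) : J (A x) = A x := by simp [A, hJJ, add_comm]
    have hJB (x : H₀) : J (B x) = -B x := by simp [B, hJJ, ← smul_neg]
    have hAB (x : H₀) : A x + B x = x := by simp [A, B]; module
    have hle (k : H₀) (hk : k ∈ K) : ‖B k‖ ≤ ‖A k‖ := by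
      have h := hpos k hk
      rw [← hAB k, map_add, hJA, hJB, ← sub_eq_add_neg, re_inner_add_sub_self] at h
      exact (sq_le_sq₀ (norm_nonneg _) (norm_nonneg _)).1 (sub_nonneg.1 h)
    obtain ⟨hinj, hclosed⟩ := injective_and_isClosed_range_of_norm_le K hKc A B hAB hle
    let f : K →ₗ[ℂ] H₀ := (A ∘L K.subtypeL : K →L[ℂ] H₀)
    let e : K ≃ₗ[ℂ] f.range := LinearEquiv.ofInjective f hinj
    have he (p : f.range) : A (e.symm p) = p := congr_arg Subtype.val (e.apply_symm_apply p)
    refine ⟨f.range, hclosed, ?_,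
      B.toLinearMap ∘ₗ K.subtype ∘ₗ e.symm.toLinearMap, fun p ↦ hJB _, fun p ↦ ?_, ?_⟩
    · rintro _ ⟨k, rfl⟩
      exact hJA k
    · have h := hle _ (e.symm p).2
      rwa [he] at h
    · have hsum (p : f.range) : (p : H₀) + B (e.symm p) = e.symm p := by
        rw [← he p, hAB]
      ext x
      constructor
      · intro hx
        refine ⟨e ⟨x, hx⟩, (hsum _).trans ?_⟩
        simp
      · rintro ⟨p, rfl⟩
        exact (hsum p).symm ▸ (e.symm p).2
  · rintro ⟨P, -, hP, Λ, hΛ, hle, hK⟩ k hk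
    obtain ⟨p, rfl⟩ : k ∈ {x : H₀ | ∃ p : P, (p : H₀) + Λ p = x} := hK ▸ hk
    rw [map_add, hP p p.2, hΛ, ← sub_eq_add_neg, re_inner_add_sub_self, sub_nonneg]
    exact pow_le_pow_left₀ (norm_nonneg _) (hle p) 2
end

section
/- Let J be a period-2 unitary on a complex Hilbert space H₀ and let P₊ = (1/2)(I + J) be the orthogonal projection onto the +1 eigenspace H₊ of J. If K ⊆ H₀ is a closed J-positive subspace, then the image P₊(K) is a closed subspace of H₊. -/
open scoped ComplexConjugate

local notation "⟪" x ", " y "⟫" => @inner ℂ _ _ x y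

/-- On a vector with `0 ≤ Re ⟪k, J k⟫`, the map `½(I + J)` is bounded below. -/
theorem norm_le_two_mul_norm_half_one_add_apply {H₀ : Type*}
    [NormedAddCommGroup H₀] [InnerProductSpace ℂ H₀]
    (J : H₀ →L[ℂ] H₀) {k : H₀} (hk : 0 ≤ (⟪k, J k⟫).re) :
    ‖k‖ ≤ 2 * ‖((2⁻¹ : ℂ) • (1 + J) : H₀ →L[ℂ] H₀) k‖ := by
  have hnorm : 2 * ‖((2⁻¹ : ℂ) • (1 + J) : H₀ →L[ℂ] H₀) k‖ = ‖k + J k‖ := by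
    rw [smul_apply, norm_smul]
    simp
  have hsq := norm_add_sq (𝕜 := ℂ) k (J k)
  rw [RCLike.re_eq_complex_re] at hsq
  rw [hnorm]
  refine (sq_le_sq₀ (norm_nonneg _) (norm_nonneg _)).mp ?_
  nlinarith [sq_nonneg ‖J k‖]

/-- for a closed `J`-positive subspace `K`, the image of `K` under the
projection `P₊ = ½(I + J)` is a closed subspace of the `+1` eigenspace of `J`. -/
theorem jpositive_projection_image_closed {H₀ : Type*}
    [NormedAddCommGroup H₀] [InnerProductSpace ℂ H₀] [CompleteSpace H₀]
    (J : H₀ →L[ℂ] H₀) (hJ2 : J ∘L J = 1) (hJiso : ∀ x : H₀, ‖J x‖ = ‖x‖)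
    (K : Submodule ℂ H₀) (hKc : IsClosed (K : Set H₀))
    (hpos : ∀ k ∈ K, 0 ≤ (⟪k, J k⟫).re) :
    IsClosed ((((2⁻¹ : ℂ) • (1 + J) : H₀ →L[ℂ] H₀)) '' (K : Set H₀)) ∧
      ∀ x ∈ (((2⁻¹ : ℂ) • (1 + J) : H₀ →L[ℂ] H₀)) '' (K : Set H₀), J x = x := by
  constructor
  · set P : H₀ →L[ℂ] H₀ := (2⁻¹ : ℂ) • (1 + J)
    have : CompleteSpace K := hKc.completeSpace_coe
    have hanti : AntilipschitzWith 2 (P ∘L K.subtypeL) :=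
      (P ∘L K.subtypeL).antilipschitz_of_bound fun k =>
        norm_le_two_mul_norm_half_one_add_apply J (hpos k k.2)
    have hclosed := hanti.isClosed_range (P ∘L K.subtypeL).uniformContinuous
    have hrange : Set.range (P ∘L K.subtypeL) = P '' (K : Set H₀) := by
      ext x
      simp
    rwa [hrange] at hclosed
  · rintro _ ⟨k, -, rfl⟩
    have hJJ : J (J k) = k := DFunLike.congr_fun hJ2 k
    simp [hJJ, add_comm]
end

section
/- Let Γ be a closed, densely defined linear operator on a complex Hilbert space H (its graph { (h, Γ h) : h ∈ D(Γ) } is a closed subspace of H × H and D(Γ) is dense) such that both Γ and its adjoint Γ* are dissipative: Re⟨h, Γ h⟩ ≥ 0 for all h ∈ D(Γ) and Re⟨h, Γ* h⟩ ≥ 0 for all h ∈ D(Γ*). Then (I + Γ) maps D(Γ) onto H: for every y ∈ H there exists h ∈ D(Γ) with h + Γ h = y. -/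
open scoped ComplexConjugate

local notation "⟪" x ", " y "⟫" => @inner ℂ _ _ x y

/-- If `Γ` is dissipative, the graph norm of `Γ` is bounded by `‖h + Γ h‖`. -/
theorem LinearPMap.antilipschitz_fst_add_snd_graph
    {H : Type*} [NormedAddCommGroup H] [InnerProductSpace ℂ H] (Γ : H →ₗ.[ℂ] H)
    (hdiss : ∀ h : Γ.domain, 0 ≤ (⟪(h : H), Γ h⟫).re) :
    AntilipschitzWith 1
      ((ContinuousLinearMap.fst ℂ H H + ContinuousLinearMap.snd ℂ H H).comp Γ.graph.subtypeL) := by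
  refine ContinuousLinearMap.antilipschitz_of_bound _ fun ⟨⟨a, b⟩, hab⟩ => ?_
  obtain ⟨h, rfl, rfl⟩ := (Γ.mem_graph_iff).1 hab
  have hsq := norm_add_sq (𝕜 := ℂ) (h : H) (Γ h)
  have hre : 0 ≤ RCLike.re ⟪(h : H), Γ h⟫ := hdiss h
  suffices max ‖(h : H)‖ ‖Γ h‖ ≤ ‖(h : H) + Γ h‖ by simpa [Prod.norm_def] using this
  refine max_le ?_ ?_ <;> refine le_of_sq_le_sq ?_ (norm_nonneg _)
  · nlinarith [sq_nonneg ‖Γ h‖]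
  · nlinarith [sq_nonneg ‖(h : H)‖]

/-- If the adjoint of `Γ` is dissipative, only `0` is orthogonal to the range of `I + Γ`. -/
theorem LinearPMap.eq_zero_of_forall_inner_add_eq_zero
    {H : Type*} [NormedAddCommGroup H] [InnerProductSpace ℂ H] [CompleteSpace H]
    (Γ : H →ₗ.[ℂ] H) (hdense : Dense (Γ.domain : Set H))
    (hdiss' : ∀ h : Γ.adjoint.domain, 0 ≤ (⟪(h : H), Γ.adjoint h⟫).re)
    {k : H} (hk : ∀ h : Γ.domain, ⟪k, (h : H) + Γ h⟫ = 0) : k = 0 := by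
  have hneg : ∀ h : Γ.domain, ⟪-k, (h : H)⟫ = ⟪k, Γ h⟫ := fun h => by
    rw [inner_neg_left, neg_eq_iff_add_eq_zero, ← inner_add_right, hk h]
  have hmem : k ∈ Γ.adjoint.domain := Γ.mem_adjoint_domain_of_exists k ⟨-k, hneg⟩
  have hre := hdiss' ⟨k, hmem⟩
  rw [LinearPMap.adjoint_apply_eq hdense ⟨k, hmem⟩ hneg, inner_neg_right, Complex.neg_re] at hre
  have hnorm : (⟪k, k⟫).re = ‖k‖ ^ 2 := inner_self_eq_norm_sq (𝕜 := ℂ) k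
  exact norm_eq_zero.1 (pow_eq_zero_iff two_ne_zero |>.1 (by nlinarith [sq_nonneg ‖k‖]))

/-- a closed, densely defined operator `Γ` on a complex Hilbert space such
that both `Γ` and its adjoint `Γ*` are dissipative satisfies `(I + Γ) D(Γ) = H`. -/
theorem range_one_add_dissipative_eq_top
    {H : Type*} [NormedAddCommGroup H] [InnerProductSpace ℂ H] [CompleteSpace H]
    (Γ : H →ₗ.[ℂ] H) (hdense : Dense (Γ.domain : Set H)) (hclosed : Γ.IsClosed)
    (hdiss : ∀ h : Γ.domain, 0 ≤ (⟪(h : H), Γ h⟫).re)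
    (hdiss' : ∀ h : Γ.adjoint.domain, 0 ≤ (⟪(h : H), Γ.adjoint h⟫).re) :
    ∀ y : H, ∃ h : Γ.domain, (h : H) + Γ h = y := by
  set f := (ContinuousLinearMap.fst ℂ H H + ContinuousLinearMap.snd ℂ H H).comp Γ.graph.subtypeL
  have : CompleteSpace Γ.graph := hclosed.isComplete.completeSpace_coe
  have hrange : IsClosed (f.range : Set H) :=
    (Γ.antilipschitz_fst_add_snd_graph hdiss).isClosed_range f.uniformContinuous
  have : CompleteSpace f.range := hrange.isComplete.completeSpace_coe
  have htop : f.range = ⊤ := by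
    rw [← Submodule.orthogonal_eq_bot_iff, Submodule.eq_bot_iff]
    intro k hk
    refine Γ.eq_zero_of_forall_inner_add_eq_zero hdense hdiss' fun h => ?_
    exact Submodule.inner_left_of_mem_orthogonal (K := f.range) ⟨⟨_, Γ.mem_graph h⟩, rfl⟩ hk
  intro y
  obtain ⟨⟨⟨a, b⟩, hab⟩, rfl⟩ := htop.ge (Submodule.mem_top (x := y))
  obtain ⟨h, rfl, rfl⟩ := (Γ.mem_graph_iff).1 hab
  exact ⟨h, rfl⟩
end

section
/- Let μ be a finite positive Borel measure on ℝ with μ(ℝ ∖ [−1, 1]) = 0 and suppose ∫ (1 − x²)^{−1/2} dμ(x) < ∞. Then the moment sequence γₙ = ∫ xⁿ dμ(x), n = 0, 1, 2, …, is square-summable: ∑ₙ γₙ² < ∞. -/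
open MeasureTheory

/-- `1 / (1 - |x y|)` is dominated by the product of the weights `(1 - x²)^{-1/2}`. -/
theorem inv_one_sub_enorm_mul_le {x y : ℝ} (hx : x ∈ Set.Icc (-1 : ℝ) 1)
    (hy : y ∈ Set.Icc (-1 : ℝ) 1) :
    (1 - ‖x‖ₑ * ‖y‖ₑ)⁻¹ ≤ (ENNReal.ofReal (1 - x ^ 2)) ^ (-(1 / 2) : ℝ) *
      (ENNReal.ofReal (1 - y ^ 2)) ^ (-(1 / 2) : ℝ) := by
  have h_nonneg {z : ℝ} (hz : z ∈ Set.Icc (-1 : ℝ) 1) : 0 ≤ 1 - z ^ 2 := by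
    nlinarith [hz.1, hz.2]
  have h_weight {z : ℝ} (hz : z ∈ Set.Icc (-1 : ℝ) 1) :
      (ENNReal.ofReal (1 - z ^ 2)) ^ (-(1 / 2) : ℝ) =
        (ENNReal.ofReal √(1 - z ^ 2))⁻¹ := by
    rw [ENNReal.rpow_neg, ENNReal.ofReal_rpow_of_nonneg (h_nonneg hz) (by norm_num),
      Real.sqrt_eq_rpow]
  rw [h_weight hx, h_weight hy,
    ← ENNReal.mul_inv (Or.inr ENNReal.ofReal_ne_top) (Or.inl ENNReal.ofReal_ne_top),
    ENNReal.inv_le_inv, Real.enorm_eq_ofReal_abs, Real.enorm_eq_ofReal_abs,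
    ← ENNReal.ofReal_mul (abs_nonneg _), ← ENNReal.ofReal_mul (Real.sqrt_nonneg _),
    ← ENNReal.ofReal_one, ← ENNReal.ofReal_sub _ (by positivity)]
  apply ENNReal.ofReal_le_ofReal
  nlinarith [sq_nonneg (√(1 - x ^ 2) - √(1 - y ^ 2)), sq_nonneg (|x| - |y|),
    Real.sq_sqrt (h_nonneg hx), Real.sq_sqrt (h_nonneg hy), sq_abs x, sq_abs y]

/-- The sum of the squared absolute moments as a double integral of a geometric series. -/
theorem tsum_lintegral_enorm_pow_sq (μ : Measure ℝ) [SFinite μ] :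
    ∑' n : ℕ, (∫⁻ x, ‖x‖ₑ ^ n ∂μ) ^ 2 = ∫⁻ x, ∫⁻ y, (1 - ‖x‖ₑ * ‖y‖ₑ)⁻¹ ∂μ ∂μ := by
  have h_sq (n : ℕ) :
      (∫⁻ x, ‖x‖ₑ ^ n ∂μ) ^ 2 = ∫⁻ x, ∫⁻ y, (‖x‖ₑ * ‖y‖ₑ) ^ n ∂μ ∂μ := by
    simp_rw [mul_pow]
    rw [lintegral_lintegral_mul (by fun_prop) (by fun_prop), sq]
  simp_rw [h_sq, ← ENNReal.tsum_geometric]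
  rw [← lintegral_tsum fun n => (Measurable.lintegral_prod_right' (f := fun p : ℝ × ℝ =>
    (‖p.1‖ₑ * ‖p.2‖ₑ) ^ n) (by fun_prop)).aemeasurable]
  refine lintegral_congr fun x => ?_
  rw [← lintegral_tsum fun n => by fun_prop]

/-- if `μ` is a finite positive Borel measure supported in `[−1,1]` with
`∫ (1 − x²)^{−1/2} dμ < ∞`, then its moment sequence `γₙ = ∫ xⁿ dμ` is square-summable. -/
theorem moments_sq_summable_of_carleson_type
    (μ : Measure ℝ) [IsFiniteMeasure μ] (hsupp : μ (Set.Icc (-1 : ℝ) 1)ᶜ = 0)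
    (hint : ∫⁻ x, (ENNReal.ofReal (1 - x ^ 2)) ^ (-(1 / 2) : ℝ) ∂μ ≠ ⊤) :
    Summable fun n : ℕ => (∫ x, x ^ n ∂μ) ^ 2 := by
  have h_ae : ∀ᵐ x ∂μ, x ∈ Set.Icc (-1 : ℝ) 1 := hsupp
  have h_moment (n : ℕ) : ‖∫ x, x ^ n ∂μ‖ₑ ≤ ∫⁻ x, ‖x‖ₑ ^ n ∂μ := by
    simpa only [enorm_pow] using enorm_integral_le_lintegral_enorm (μ := μ) fun x : ℝ => x ^ n
  have h_tsum : ∑' n : ℕ, ‖∫ x, x ^ n ∂μ‖ₑ ^ 2 ≠ ⊤ := by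
    refine ne_top_of_le_ne_top (ENNReal.mul_ne_top hint hint) ?_
    calc ∑' n : ℕ, ‖∫ x, x ^ n ∂μ‖ₑ ^ 2
        ≤ ∑' n : ℕ, (∫⁻ x, ‖x‖ₑ ^ n ∂μ) ^ 2 :=
          ENNReal.tsum_le_tsum fun n => pow_le_pow_left' (h_moment n) 2
      _ = ∫⁻ x, ∫⁻ y, (1 - ‖x‖ₑ * ‖y‖ₑ)⁻¹ ∂μ ∂μ := tsum_lintegral_enorm_pow_sq μ
      _ ≤ ∫⁻ x, ∫⁻ y, (ENNReal.ofReal (1 - x ^ 2)) ^ (-(1 / 2) : ℝ) *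
            (ENNReal.ofReal (1 - y ^ 2)) ^ (-(1 / 2) : ℝ) ∂μ ∂μ := by
          refine lintegral_mono_ae ?_
          filter_upwards [h_ae] with x hx
          refine lintegral_mono_ae ?_
          filter_upwards [h_ae] with y hy using inv_one_sub_enorm_mul_le hx hy
      _ = _ := lintegral_lintegral_mul (by fun_prop) (by fun_prop)
  simpa using ENNReal.summable_toReal h_tsum
end

section
/- Let N ∈ ℕ, let z : Fin N → ℂ satisfy |zᵢ| < 1 for all i, and let w, c : Fin N → ℂ. Then both series below converge and ∑_{n=0}^∞ |∑ᵢ cᵢ zᵢⁿ|² − ∑_{n=0}^∞ |∑ᵢ cᵢ wᵢ zᵢⁿ|² = ∑ᵢ ∑ⱼ conj(cᵢ) · cⱼ · (1 − conj(wᵢ) wⱼ)/(1 − conj(zᵢ) zⱼ). -/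
open scoped ComplexConjugate

/-- The square-sum of a finite combination of geometric sequences, in terms of the Szegő kernel
`1 / (1 - conj ζ * z)`. -/
theorem hasSum_norm_sq_sum_mul_pow {ι : Type*} [Fintype ι] (z a : ι → ℂ) (hz : ∀ i, ‖z i‖ < 1) :
    HasSum (fun n : ℕ => ((‖∑ i, a i * z i ^ n‖ ^ 2 : ℝ) : ℂ))
      (∑ i, ∑ j, conj (a i) * a j * (1 - conj (z i) * z j)⁻¹) := by
  have expand (n : ℕ) : ((‖∑ i, a i * z i ^ n‖ ^ 2 : ℝ) : ℂ) =
      ∑ i, ∑ j, conj (a i) * a j * (conj (z i) * z j) ^ n := by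
    rw [Complex.ofReal_pow, ← Complex.conj_mul', map_sum, Finset.sum_mul_sum]
    refine Finset.sum_congr rfl fun i _ => Finset.sum_congr rfl fun j _ => ?_
    rw [map_mul, map_pow]
    ring
  have norm_lt (i j : ι) : ‖conj (z i) * z j‖ < 1 := by
    rw [norm_mul, RCLike.norm_conj]
    exact mul_lt_one_of_nonneg_of_lt_one_left (norm_nonneg _) (hz i) (hz j).le
  have geom (i j : ι) : HasSum (fun n : ℕ => conj (a i) * a j * (conj (z i) * z j) ^ n)
      (conj (a i) * a j * (1 - conj (z i) * z j)⁻¹) :=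
    (hasSum_geometric_of_norm_lt_one (norm_lt i j)).mul_left _
  rw [funext expand]
  exact hasSum_sum fun i _ => hasSum_sum fun j _ => geom i j

/-- the Pick–Nevanlinna computation: for points `zᵢ` in the open unit disc and
complex numbers `wᵢ, cᵢ`, both geometric-type series are summable and
`∑ₙ |∑ᵢ cᵢ zᵢⁿ|² − ∑ₙ |∑ᵢ cᵢ wᵢ zᵢⁿ|² = ∑ᵢ∑ⱼ conj(cᵢ) cⱼ (1 − conj(wᵢ)wⱼ)/(1 − conj(zᵢ)zⱼ)`. -/
theorem pick_nevanlinna_identity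
    (N : ℕ) (z w c : Fin N → ℂ) (hz : ∀ i, ‖z i‖ < 1) :
    (Summable fun n : ℕ => ‖∑ i, c i * z i ^ n‖ ^ 2) ∧
    (Summable fun n : ℕ => ‖∑ i, c i * w i * z i ^ n‖ ^ 2) ∧
    ((∑' n : ℕ, ‖∑ i, c i * z i ^ n‖ ^ 2 : ℝ) : ℂ) -
        ((∑' n : ℕ, ‖∑ i, c i * w i * z i ^ n‖ ^ 2 : ℝ) : ℂ) =
      ∑ i, ∑ j, conj (c i) * c j * ((1 - conj (w i) * w j) / (1 - conj (z i) * z j)) := by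
  have h₁ := hasSum_norm_sq_sum_mul_pow z c hz
  have h₂ := hasSum_norm_sq_sum_mul_pow z (fun i => c i * w i) hz
  refine ⟨Complex.summable_ofReal.mp h₁.summable, Complex.summable_ofReal.mp h₂.summable, ?_⟩
  rw [Complex.ofReal_tsum, Complex.ofReal_tsum, h₁.tsum_eq, h₂.tsum_eq, ← Finset.sum_sub_distrib]
  refine Finset.sum_congr rfl fun i _ => ?_
  rw [← Finset.sum_sub_distrib]
  refine Finset.sum_congr rfl fun j _ => ?_
  rw [map_mul]
  ring
end
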